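/- Fix n ≥ 2 and c > 0, and let p = (0,1,0,…,0) ∈ S^{n+1} ⊂ ℝ^{n+2}. Then for all s ∈ ℝ and y ∈ ℝ^{n-1}, Ψ(T_c(s,y))(p) = σ(e^{cs}cos s, e^{cs}sin s, y₁, …, y_{n-1}). Consequently the orbit {Ψ(T_c(s,y))(p) : s ∈ ℝ, y ∈ ℝ^{n-1}} equals the image under σ of the logarithmic spiral cylinder f(s,y) = (e^{cs}cos s, e^{cs}sin s, y) in ℝ^{n+1}; in particular the logarithmic spiral cylinder is a Möbius homogeneous hypersurface of S^{n+1}. -/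

import Mathlib

open Matrix Real

/-- The logarithmic-spiral-cylinder group element `T_c(s,y)`.
Here `n = m + 2` (so `n ≥ 2`), the matrix has size `n+3 = m+5`, and
`y ∈ ℝ^{n-1}` is encoded as `y : Fin (m+1) → ℝ`. -/
noncomputable def Tc (m : ℕ) (c s : ℝ) (y : Fin (m + 1) → ℝ) :
    Matrix (Fin (m + 5)) (Fin (m + 5)) ℝ :=
  Matrix.of fun i j =>
    if i.val = 0 then
      if j.val = 0 then (1 + (∑ k, y k ^ 2) + exp (2 * c * s)) / (2 * exp (c * s))
      else if j.val = 1 then (1 + (∑ k, y k ^ 2) - exp (2 * c * s)) / (2 * exp (c * s))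
      else if h : 4 ≤ j.val then y ⟨j.val - 4, by have := j.isLt; omega⟩ else 0
    else if i.val = 1 then
      if j.val = 0 then (1 - (∑ k, y k ^ 2) - exp (2 * c * s)) / (2 * exp (c * s))
      else if j.val = 1 then (1 - (∑ k, y k ^ 2) + exp (2 * c * s)) / (2 * exp (c * s))
      else if h : 4 ≤ j.val then -y ⟨j.val - 4, by have := j.isLt; omega⟩ else 0
    else if i.val = 2 then
      if j.val = 2 then cos s else if j.val = 3 then -sin s else 0
    else if i.val = 3 then
      if j.val = 2 then sin s else if j.val = 3 then cos s else 0
    else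
      if h : 4 ≤ i.val then
        if j.val = 0 ∨ j.val = 1 then y ⟨i.val - 4, by have := i.isLt; omega⟩ * exp (-(c * s))
        else if j.val = i.val then 1 else 0
      else 0

/-- For `T = [[w,u],[v,Q]]`, the Möbius transformation
`Ψ(T)(x) = (Qx + v)/(u·x + w)` of the sphere `S^{n+1}` (with `n+2 = m+4`). -/
noncomputable def Psi (m : ℕ) (T : Matrix (Fin (m + 5)) (Fin (m + 5)) ℝ)
    (x : Fin (m + 4) → ℝ) : Fin (m + 4) → ℝ :=
  fun i => ((∑ j, T i.succ j.succ * x j) + T i.succ 0)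
    / ((∑ j, T 0 j.succ * x j) + T 0 0)

/-- Inverse stereographic projection `σ : ℝ^{n+1} → S^{n+1}`,
`σ(u) = ((1-|u|²)/(1+|u|²), 2u/(1+|u|²))` (with `n+1 = m+3`). -/
noncomputable def sigmaMap (m : ℕ) (u : Fin (m + 3) → ℝ) : Fin (m + 4) → ℝ :=
  Fin.cons ((1 - ∑ k, u k ^ 2) / (1 + ∑ k, u k ^ 2))
    (fun j => 2 * u j / (1 + ∑ k, u k ^ 2))

/-- The logarithmic spiral cylinder `f(s,y) = (e^{cs}cos s, e^{cs}sin s, y) ∈ ℝ^{n+1}`. -/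
noncomputable def logSpiralCyl (m : ℕ) (c s : ℝ) (y : Fin (m + 1) → ℝ) :
    Fin (m + 3) → ℝ :=
  fun i =>
    if i.val = 0 then exp (c * s) * cos s
    else if i.val = 1 then exp (c * s) * sin s
    else y ⟨i.val - 2, by have := i.isLt; omega⟩

/-- `Ψ(T)` at the second coordinate vector only involves two columns of `T`. -/
theorem Psi_basis_one (m : ℕ) (T : Matrix (Fin (m + 5)) (Fin (m + 5)) ℝ) (i : Fin (m + 4)) :
    Psi m T (fun i => if i.val = 1 then 1 else 0) i
      = (T i.succ 2 + T i.succ 0) / (T 0 2 + T 0 0) := by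
  have key (k : Fin (m + 5)) :
      ∑ j : Fin (m + 4), T k j.succ * (if j.val = 1 then 1 else 0) = T k 2 := by
    rw [Finset.sum_eq_single (1 : Fin (m + 4))]
    · simp
    · intro j _ hj
      have : j.val ≠ 1 := fun h => hj (Fin.ext (by simpa using h))
      simp [this]
    · simp
  simp only [Psi, key]

theorem sum_sq_logSpiralCyl (m : ℕ) (c s : ℝ) (y : Fin (m + 1) → ℝ) :
    ∑ k, logSpiralCyl m c s y k ^ 2 = exp (c * s) ^ 2 + ∑ k, y k ^ 2 := by
  rw [Fin.sum_univ_succ, Fin.sum_univ_succ]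
  simp only [logSpiralCyl, Fin.val_succ, Fin.val_zero]
  simp only [Nat.add_eq_zero_iff, one_ne_zero, and_false, if_false, if_true, Nat.add_eq_right,
    zero_add]
  have hy : ∑ k : Fin (m + 1), y ⟨k.val + 1 + 1 - 2, by have := k.isLt; omega⟩ ^ 2
      = ∑ k, y k ^ 2 := rfl
  linear_combination hy + exp (c * s) ^ 2 * cos_sq_add_sin_sq s

theorem Psi_Tc_basis_one (m : ℕ) (c s : ℝ) (y : Fin (m + 1) → ℝ) :
    Psi m (Tc m c s y) (fun i => if i.val = 1 then 1 else 0)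
      = sigmaMap m (logSpiralCyl m c s y) := by
  have hexp : exp (2 * c * s) = exp (c * s) ^ 2 := by
    rw [← exp_nat_mul]; congr 1; push_cast; ring
  have hE : exp (c * s) ≠ 0 := (exp_pos _).ne'
  have h2 : 2 % (m + 5) = 2 := Nat.mod_eq_of_lt (by omega)
  have h2' : 2 % (m + 1 + 1 + 1 + 1) = 2 := Nat.mod_eq_of_lt (by omega)
  have h20 : (2 : Fin (m + 5)) ≠ 0 := fun h => by simpa [h2] using congrArg Fin.val h
  funext i
  rw [Psi_basis_one]
  refine Fin.cases ?_ (fun j => ?_) i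
  · simp only [sigmaMap, Fin.cons_zero, sum_sq_logSpiralCyl]
    simp [Tc, h2, h20, hexp]
    field_simp
    ring
  · simp only [sigmaMap, Fin.cons_succ, sum_sq_logSpiralCyl]
    refine Fin.cases ?_ (fun k => Fin.cases ?_ (fun l => ?_) k) j
    · simp [Tc, logSpiralCyl, h2, h20, hexp]
      field_simp
      ring
    · simp [Tc, logSpiralCyl, h2, h2', h20, hexp]
      field_simp
      ring
    · simp [Tc, logSpiralCyl, h2, h20, hexp, Real.exp_neg]
      field_simp
      ring

/-- With `p = (0,1,0,…,0) ∈ S^{n+1}`, we have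
`Ψ(T_c(s,y))(p) = σ(e^{cs}cos s, e^{cs}sin s, y)`; consequently the orbit of `p` under
the group `{T_c(s,y)}` is exactly the image under `σ` of the logarithmic spiral
cylinder, which is therefore a Möbius homogeneous hypersurface of `S^{n+1}`. -/
theorem logSpiral_orbit (m : ℕ) (c : ℝ) (hc : 0 < c) :
    (∀ (s : ℝ) (y : Fin (m + 1) → ℝ),
      Psi m (Tc m c s y) (fun i => if i.val = 1 then 1 else 0)
        = sigmaMap m (logSpiralCyl m c s y)) ∧
    {x : Fin (m + 4) → ℝ | ∃ (s : ℝ) (y : Fin (m + 1) → ℝ),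
        x = Psi m (Tc m c s y) (fun i => if i.val = 1 then 1 else 0)}
      = {x : Fin (m + 4) → ℝ | ∃ (s : ℝ) (y : Fin (m + 1) → ℝ),
        x = sigmaMap m (logSpiralCyl m c s y)} := by
  refine ⟨Psi_Tc_basis_one m c, ?_⟩
  simp only [Psi_Tc_basis_one]
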